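/- (Corollary, case h = 3/q with q ≡ 2 mod 3) As q → ∞ through integers q = 3ν+2 (ν = 2, 3, …), with h = 3/q one has A(h) = h + (16π²/243)h³ + (16π³√3/2187)h⁴ + (448π⁴/59049)h⁵ + O(h⁶). -/

import Mathlib

open Real Asymptotics Filter

/-- Membership in the Turán class `K(h)`, encoded via the nonnegative Fourier cosine
coefficient sequence `a` of a continuous 1-periodic even function
`f(x) = ∑' n, a n * cos (2πnx)`: all `a n ≥ 0`, `∑ a n = 1` (so `f 0 = 1`), and
`f x = 0` for `h ≤ |x| ≤ 1/2`. -/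
def memK (h : ℝ) (a : ℕ → ℝ) : Prop :=
  (∀ n, 0 ≤ a n) ∧ Summable a ∧ (∑' n, a n) = 1 ∧
    ∀ x : ℝ, h ≤ |x| → |x| ≤ 1 / 2 → (∑' n : ℕ, a n * Real.cos (2 * π * n * x)) = 0

/-- The Turán constant `A(h) = sup_{f ∈ K(h)} a₀`. -/
noncomputable def turanA (h : ℝ) : ℝ :=
  sSup {y : ℝ | ∃ a : ℕ → ℝ, memK h a ∧ y = a 0}

theorem hasSum_one_div_sq_mul_cos {y : ℝ} (hy : |y| ≤ 1) :
    HasSum (fun n : ℕ => 1 / (n : ℝ) ^ 2 * cos (2 * π * n * y)) (π ^ 2 * (y ^ 2 - |y| + 1 / 6)) := by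
  have h := hasSum_one_div_nat_pow_mul_cos one_ne_zero (x := |y|) ⟨abs_nonneg y, hy⟩
  have hB : (Polynomial.map (algebraMap ℚ ℝ) (Polynomial.bernoulli 2)).eval |y| =
      y ^ 2 - |y| + 1 / 6 := by
    simp [Polynomial.bernoulli_def, Finset.sum_range_succ, bernoulli_two]
    ring
  convert h using 1
  · ext n
    rw [← cos_abs (2 * π * n * y), abs_mul, abs_of_nonneg (by positivity : 0 ≤ 2 * π * (n : ℝ)),
      mul_one]
  · rw [mul_one, hB, Nat.factorial_two]
    push_cast
    ring

theorem sum_range_cos_nonneg (q : ℕ) (m : ℤ) :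
    0 ≤ ∑ k ∈ Finset.range q, cos (2 * π * m * k / q) := by
  rcases Nat.eq_zero_or_pos q with rfl | hq
  · simp
  have hq' : (q : ℂ) ≠ 0 := by exact_mod_cast hq.ne'
  set z : ℂ := Complex.exp (2 * π * Complex.I * m / q) with hz
  have hzk (k : ℕ) : (z ^ k).re = cos (2 * π * m * k / q) := by
    rw [hz, ← Complex.exp_nat_mul, ← Complex.exp_ofReal_mul_I_re]
    congr 2
    push_cast
    ring
  have hzq : z ^ q = 1 := by
    rw [hz, ← Complex.exp_nat_mul, Complex.exp_eq_one_iff]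
    exact ⟨m, by field_simp⟩
  have hsum : ∑ k ∈ Finset.range q, cos (2 * π * m * k / q) =
      (∑ k ∈ Finset.range q, z ^ k).re := by
    simp [hzk]
  rw [hsum]
  by_cases h1 : z = 1
  · simp [h1]
  · rw [geom_sum_eq h1, hzq]
    simp

theorem sum_range_cos_mul_cos_nonneg (q n j : ℕ) :
    0 ≤ ∑ k ∈ Finset.range q, cos (2 * π * n * (k / q)) * cos (2 * π * j * k / q) := by
  have h : ∑ k ∈ Finset.range q, cos (2 * π * n * (k / q)) * cos (2 * π * j * k / q) =
      (∑ k ∈ Finset.range q, cos (2 * π * ((n + j : ℤ) : ℝ) * k / q) +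
        ∑ k ∈ Finset.range q, cos (2 * π * ((n - j : ℤ) : ℝ) * k / q)) / 2 := by
    rw [← Finset.sum_add_distrib, Finset.sum_div]
    refine Finset.sum_congr rfl fun k _ => ?_
    have e1 : 2 * π * ((n + j : ℤ) : ℝ) * k / q =
        2 * π * n * (k / q) + 2 * π * j * k / q := by push_cast; ring
    have e2 : 2 * π * ((n - j : ℤ) : ℝ) * k / q =
        2 * π * n * (k / q) - 2 * π * j * k / q := by push_cast; ring
    rw [e1, e2, cos_add, cos_sub]
    ring
  rw [h]
  have := sum_range_cos_nonneg q (n + j)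
  have := sum_range_cos_nonneg q (n - j)
  positivity

/-- The cosine series with coefficients `a`. -/
noncomputable def cosSeries (a : ℕ → ℝ) (x : ℝ) : ℝ := ∑' n : ℕ, a n * cos (2 * π * n * x)

theorem cosSeries_one_sub (a : ℕ → ℝ) (x : ℝ) : cosSeries a (1 - x) = cosSeries a x := by
  refine tsum_congr fun n => ?_
  rw [show 2 * π * n * (1 - x) = n * (2 * π) - 2 * π * n * x by ring, cos_nat_mul_two_pi_sub]

namespace memK

variable {h : ℝ} {a : ℕ → ℝ}

theorem summable_mul (ha : memK h a) (x : ℝ) :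
    Summable fun n : ℕ => a n * cos (2 * π * n * x) := by
  refine Summable.of_norm_bounded ha.2.1 fun n => ?_
  rw [norm_mul, norm_of_nonneg (ha.1 n)]
  exact mul_le_of_le_one_right (ha.1 n) (abs_cos_le_one _)

theorem cosSeries_zero (ha : memK h a) : cosSeries a 0 = 1 := by
  simp [cosSeries, ha.2.2.1]

theorem cosSeries_eq_zero (ha : memK h a) {x : ℝ} (hx0 : 0 ≤ x) (hx : h ≤ x) (hx' : x ≤ 1 - h)
    (hx1 : x ≤ 1) : cosSeries a x = 0 := by
  rcases le_total x (1 / 2) with hh | hh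
  · exact ha.2.2.2 x (by rwa [abs_of_nonneg hx0]) (by rwa [abs_of_nonneg hx0])
  · rw [← cosSeries_one_sub]
    refine ha.2.2.2 (1 - x) ?_ ?_ <;> rw [abs_of_nonneg (by linarith)] <;> linarith

theorem hasSum_sum_range (ha : memK h a) (q j : ℕ) :
    HasSum (fun n => a n * ∑ k ∈ Finset.range q,
      cos (2 * π * n * (k / q)) * cos (2 * π * j * k / q))
      (∑ k ∈ Finset.range q, cosSeries a (k / q) * cos (2 * π * j * k / q)) := by
  have := hasSum_sum (s := Finset.range q) fun k _ =>
    ((ha.summable_mul (k / q)).hasSum.mul_right (cos (2 * π * j * k / q)))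
  refine this.congr_fun fun n => ?_
  rw [Finset.mul_sum]
  exact Finset.sum_congr rfl fun k _ => by ring

theorem sum_range_nonneg (ha : memK h a) (q j : ℕ) :
    0 ≤ ∑ k ∈ Finset.range q, cosSeries a (k / q) * cos (2 * π * j * k / q) :=
  (ha.hasSum_sum_range q j).nonneg fun n =>
    mul_nonneg (ha.1 n) (sum_range_cos_mul_cos_nonneg q n j)

theorem mul_apply_zero_le_sum_range (ha : memK h a) (q : ℕ) :
    q * a 0 ≤ ∑ k ∈ Finset.range q, cosSeries a (k / q) * cos (2 * π * (0 : ℕ) * k / q) := by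
  have := le_hasSum (ha.hasSum_sum_range q 0) 0 fun n _ =>
    mul_nonneg (ha.1 n) (sum_range_cos_mul_cos_nonneg q n 0)
  simpa [mul_comm] using this

theorem sum_range_eq {q : ℕ} (hq : 5 ≤ q) (ha : memK (3 / q) a) (j : ℕ) :
    ∑ k ∈ Finset.range q, cosSeries a (k / q) * cos (2 * π * j * k / q) =
      1 + 2 * cosSeries a (1 / q) * cos (2 * π * j / q) +
        2 * cosSeries a (2 / q) * (2 * cos (2 * π * j / q) ^ 2 - 1) := by
  obtain ⟨m, rfl⟩ := Nat.exists_eq_add_of_le' hq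
  set q := m + 5 with hqd
  have hq0 : (0 : ℝ) < q := by positivity
  have hqm : (q : ℝ) = m + 5 := by rw [hqd]; push_cast; ring
  have hmid : ∑ k ∈ Finset.range m, cosSeries a (((k + 1 + 1 + 1 : ℕ) : ℝ) / q) *
      cos (2 * π * j * ((k + 1 + 1 + 1 : ℕ) : ℝ) / q) = 0 := by
    refine Finset.sum_eq_zero fun k hk => ?_
    have hk' : (k : ℝ) + 1 ≤ m := by exact_mod_cast Finset.mem_range.mp hk
    have hk0 : (0 : ℝ) ≤ k := Nat.cast_nonneg k
    rw [ha.cosSeries_eq_zero, zero_mul]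
    · positivity
    · gcongr; push_cast; linarith
    · rw [le_sub_iff_add_le, ← add_div, div_le_one hq0]; push_cast; linarith
    · rw [div_le_one hq0]; push_cast; linarith
  have e1 : ((m + 4 : ℕ) : ℝ) / q = 1 - 1 / q := by
    field_simp; push_cast; linarith
  have e2 : ((m + 3 : ℕ) : ℝ) / q = 1 - 2 / q := by
    field_simp; push_cast; linarith
  have c1 : cos (2 * π * j * ((m + 4 : ℕ) : ℝ) / q) = cos (2 * π * j / q) := by
    rw [mul_div_assoc, e1, show 2 * π * j * (1 - 1 / q) = j * (2 * π) - 2 * π * j / q by ring,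
      cos_nat_mul_two_pi_sub]
  have c2' : cos (2 * π * j * 2 / q) = 2 * cos (2 * π * j / q) ^ 2 - 1 := by
    rw [← cos_two_mul]; ring_nf
  have c2 : cos (2 * π * j * ((m + 3 : ℕ) : ℝ) / q) = 2 * cos (2 * π * j / q) ^ 2 - 1 := by
    rw [mul_div_assoc, e2, show 2 * π * j * (1 - 2 / q) = j * (2 * π) - 2 * π * j * 2 / q by ring,
      cos_nat_mul_two_pi_sub, c2']
  rw [show Finset.range q = Finset.range (m + 3 + 1 + 1) from rfl, Finset.sum_range_succ,
    Finset.sum_range_succ, Finset.sum_range_succ', Finset.sum_range_succ', Finset.sum_range_succ',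
    hmid, c2, c1, e1, e2, cosSeries_one_sub, cosSeries_one_sub]
  simp only [Nat.cast_one, Nat.cast_zero, zero_div, mul_zero, zero_add, cos_zero,
    ha.cosSeries_zero, one_add_one_eq_two, Nat.cast_ofNat, mul_one, c2']
  ring

end memK

theorem memK.apply_zero_le {q : ℕ} (hq : 5 ≤ q) {a : ℕ → ℝ} (ha : memK (3 / q) a)
    {i j : ℕ} {x y : ℝ} (hx : x = cos (2 * π * i / q)) (hy : y = cos (2 * π * j / q)) (hx1 : x < 1)
    (hx2 : -1 / 2 < x) (hy2 : y < -1 / 2) (hxy : 0 < 1 / 2 + x * y) :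
    a 0 ≤ (1 - x) * (1 - y) / (q * (1 / 2 + x * y)) := by
  have h0 := ha.mul_apply_zero_le_sum_range q
  have h1 := ha.sum_range_nonneg q i
  have h2 := ha.sum_range_nonneg q j
  rw [ha.sum_range_eq hq] at h0 h1 h2
  rw [← hx] at h1
  rw [← hy] at h2
  simp only [Nat.cast_zero, mul_zero, zero_div, cos_zero] at h0
  have hq0 : (0 : ℝ) < q := by positivity
  rw [le_div_iff₀ (by positivity)]
  set u := cosSeries a (1 / q)
  set v := cosSeries a (2 / q)
  have p1 := mul_nonneg (mul_nonneg (by linarith : 0 ≤ -(1 / 2 + y)) (by linarith : 0 ≤ 1 - y)) h1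
  have p2 := mul_nonneg (mul_nonneg (by linarith : 0 ≤ 1 / 2 + x) (by linarith : 0 ≤ 1 - x)) h2
  have p0 := mul_le_mul_of_nonneg_left h0 hxy.le
  have hd : 0 < x - y := by linarith
  refine le_of_mul_le_mul_left ?_ hd
  have p3 := mul_le_mul_of_nonneg_left p0 hd.le
  linarith

/-- The Fourier cosine coefficients of the piecewise linear function with nodes `k / q` and values
`1`, `u`, `v`, `0` at `k = 0`, `±1`, `±2`, `±3`. -/
noncomputable def hatCoeff (q : ℕ) (u v : ℝ) (n : ℕ) : ℝ :=
  (if n = 0 then (1 + 2 * u + 2 * v) / q else 0) +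
    q / π ^ 2 * ((1 + 2 * u * cos (2 * π * n / q) + 2 * v * (2 * cos (2 * π * n / q) ^ 2 - 1)) *
      (1 - cos (2 * π * n / q)) * (1 / (n : ℝ) ^ 2))

theorem hatCoeff_zero (q : ℕ) (u v : ℝ) : hatCoeff q u v 0 = (1 + 2 * u + 2 * v) / q := by
  simp [hatCoeff]

theorem hasSum_hatCoeff_mul_cos {q : ℕ} (hq : 6 ≤ q) (u v : ℝ) {x : ℝ} (hx : |x| ≤ 1 / 2) :
    HasSum (fun n : ℕ => hatCoeff q u v n * cos (2 * π * n * x))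
      ((1 + 2 * u + 2 * v) / q + q * (
        (1 - u) * (x ^ 2 - |x| + 1 / 6) +
        (u - (1 + v) / 2) * (((x + 1 / q) ^ 2 - |x + 1 / q| + 1 / 6) +
          ((x - 1 / q) ^ 2 - |x - 1 / q| + 1 / 6)) +
        (v - u / 2) * (((x + 2 / q) ^ 2 - |x + 2 / q| + 1 / 6) +
          ((x - 2 / q) ^ 2 - |x - 2 / q| + 1 / 6)) +
        (-v / 2) * (((x + 3 / q) ^ 2 - |x + 3 / q| + 1 / 6) +
          ((x - 3 / q) ^ 2 - |x - 3 / q| + 1 / 6)))) := by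
  have hq6 : (6 : ℝ) ≤ q := by exact_mod_cast hq
  have hq0 : (0 : ℝ) < q := by linarith
  have h3 : 3 / (q : ℝ) ≤ 1 / 2 := by rw [div_le_iff₀ hq0]; linarith
  have key (k : ℝ) (hk0 : 0 ≤ k) (hk : k ≤ 3) :
      HasSum (fun n : ℕ => 1 / (n : ℝ) ^ 2 * (cos (2 * π * n * x) * cos (k * (2 * π * n / q)) * 2))
        (π ^ 2 * (((x + k / q) ^ 2 - |x + k / q| + 1 / 6) +
          ((x - k / q) ^ 2 - |x - k / q| + 1 / 6))) := by
    have hkq : |k / q| ≤ 1 / 2 := by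
      rw [abs_of_nonneg (by positivity)]
      exact (div_le_div_of_nonneg_right hk hq0.le).trans h3
    have hp : |x + k / q| ≤ 1 := (abs_add_le _ _).trans (by linarith)
    have hm : |x - k / q| ≤ 1 := (abs_sub _ _).trans (by linarith)
    rw [mul_add]
    refine ((hasSum_one_div_sq_mul_cos hp).add (hasSum_one_div_sq_mul_cos hm)).congr_fun fun n => ?_
    rw [show 2 * π * n * (x + k / q) = 2 * π * n * x + k * (2 * π * n / q) by ring,
      show 2 * π * n * (x - k / q) = 2 * π * n * x - k * (2 * π * n / q) by ring, cos_add, cos_sub]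
    ring
  have h0 : HasSum (fun n : ℕ => if n = 0 then (1 + 2 * u + 2 * v) / (q : ℝ) else 0)
      ((1 + 2 * u + 2 * v) / q) := hasSum_ite_eq 0 _
  have hc := hasSum_one_div_sq_mul_cos (y := x) (by linarith)
  have h := h0.add (((((hc.mul_left (1 - u)).add
    ((key 1 (by norm_num) (by norm_num)).mul_left (u - (1 + v) / 2))).add
    ((key 2 (by norm_num) (by norm_num)).mul_left (v - u / 2))).add
    ((key 3 (by norm_num) (by norm_num)).mul_left (-v / 2))).mul_left (q / π ^ 2))
  convert h using 1
  · ext n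
    rw [hatCoeff, add_mul, cos_three_mul, cos_two_mul, one_mul]
    congr 1
    · split_ifs with hn
      · simp [hn]
      · simp
    · ring
  · have := pi_ne_zero
    field_simp

theorem memK_hatCoeff {q : ℕ} (hq : 6 ≤ q) {u v : ℝ}
    (h : ∀ n : ℕ, 0 ≤ 1 + 2 * u * cos (2 * π * n / q) + 2 * v * (2 * cos (2 * π * n / q) ^ 2 - 1)) :
    memK (3 / q) (hatCoeff q u v) := by
  have hq6 : (6 : ℝ) ≤ q := by exact_mod_cast hq
  have hq0 : (0 : ℝ) < q := by linarith
  have hsum : HasSum (hatCoeff q u v) 1 := by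
    have := hasSum_hatCoeff_mul_cos hq u v (x := 0) (by norm_num)
    simp only [mul_zero, cos_zero, mul_one, zero_add, zero_sub, abs_neg, abs_zero,
      abs_of_nonneg (by positivity : 0 ≤ 1 / (q : ℝ)), abs_of_nonneg (by positivity : 0 ≤ 2 / (q : ℝ)),
      abs_of_nonneg (by positivity : 0 ≤ 3 / (q : ℝ))] at this
    convert this using 1
    field_simp
    ring
  have hzero : ∀ x : ℝ, 3 / q ≤ x → x ≤ 1 / 2 →
      ∑' n : ℕ, hatCoeff q u v n * cos (2 * π * n * x) = 0 := by
    intro x hx hx'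
    have h1 : 1 / (q : ℝ) ≤ 3 / q := by gcongr; norm_num
    have h2 : 2 / (q : ℝ) ≤ 3 / q := by gcongr; norm_num
    have h1' : 0 < 1 / (q : ℝ) := by positivity
    have h2' : 0 < 2 / (q : ℝ) := by positivity
    have hx0 : 0 ≤ x := by linarith
    rw [(hasSum_hatCoeff_mul_cos hq u v (by rwa [abs_of_nonneg hx0])).tsum_eq,
      abs_of_nonneg hx0, abs_of_nonneg (by linarith : 0 ≤ x + 1 / q),
      abs_of_nonneg (by linarith : 0 ≤ x - 1 / q), abs_of_nonneg (by linarith : 0 ≤ x + 2 / q),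
      abs_of_nonneg (by linarith : 0 ≤ x - 2 / q), abs_of_nonneg (by linarith : 0 ≤ x + 3 / q),
      abs_of_nonneg (by linarith : 0 ≤ x - 3 / q)]
    field_simp
    ring
  refine ⟨fun n => ?_, hsum.summable, hsum.tsum_eq, fun x hx hx' => ?_⟩
  · have h1 : 0 ≤ 1 - cos (2 * π * n / q) := by linarith [cos_le_one (2 * π * n / q)]
    have h2 := h 0
    simp only [Nat.cast_zero, mul_zero, zero_div, cos_zero] at h2
    have h3 : 0 ≤ (1 + 2 * u + 2 * v) / q := div_nonneg (by linarith) hq0.le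
    have h4 := h n
    unfold hatCoeff
    split_ifs <;> positivity
  · rw [← hzero |x| hx hx']
    refine tsum_congr fun n => ?_
    rw [← cos_abs (2 * π * n * x), abs_mul, abs_of_nonneg (by positivity : 0 ≤ 2 * π * (n : ℝ))]

theorem cos_two_pi_mul_div_eq {q : ℕ} (hq : 0 < q) (n : ℕ) :
    ∃ r : ℕ, 2 * r ≤ q ∧ cos (2 * π * n / q) = cos (2 * π * r / q) := by
  have hq0 : (q : ℝ) ≠ 0 := by positivity
  have hmod : cos (2 * π * n / q) = cos (2 * π * (n % q : ℕ) / q) := by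
    have hn : (n : ℝ) = (n % q : ℕ) + q * (n / q : ℕ) := by exact_mod_cast (Nat.mod_add_div n q).symm
    rw [show 2 * π * n / q = 2 * π * (n % q : ℕ) / q + (n / q : ℕ) * (2 * π) by
      rw [hn]; field_simp, cos_add_nat_mul_two_pi]
  have hlt := Nat.mod_lt n hq
  by_cases hr : 2 * (n % q) ≤ q
  · exact ⟨n % q, hr, hmod⟩
  · refine ⟨q - n % q, by omega, ?_⟩
    rw [hmod, Nat.cast_sub hlt.le, ← cos_two_pi_sub]
    congr 1
    field_simp

theorem cos_sub_mul_cos_sub_nonneg {q i : ℕ} (hi : 2 * (i + 1) ≤ q) (n : ℕ) :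
    0 ≤ (cos (2 * π * n / q) - cos (2 * π * i / q)) *
      (cos (2 * π * n / q) - cos (2 * π * (i + 1 : ℕ) / q)) := by
  have hq : 0 < q := by omega
  obtain ⟨r, hr, h⟩ := cos_two_pi_mul_div_eq hq n
  have hanti {k l : ℕ} (hkl : k ≤ l) (hl : 2 * l ≤ q) :
      cos (2 * π * l / q) ≤ cos (2 * π * k / q) := by
    refine cos_le_cos_of_nonneg_of_le_pi (by positivity) ?_ (by gcongr)
    rw [div_le_iff₀ (by positivity)]
    have : (2 : ℝ) * l ≤ q := by exact_mod_cast hl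
    nlinarith [pi_pos]
  rw [h]
  rcases Nat.le_or_ge r i with hri | hri
  · refine mul_nonneg (sub_nonneg.2 (hanti hri (by omega))) (sub_nonneg.2 (hanti ?_ ?_)) <;> omega
  · rcases hri.eq_or_lt with rfl | hlt
    · simp
    · exact mul_nonneg_of_nonpos_of_nonpos (sub_nonpos.2 (hanti hri hr)) (sub_nonpos.2 (hanti hlt hr))

theorem turanA_three_div_eq {q i : ℕ} (hq : 6 ≤ q) (hi : 2 * (i + 1) ≤ q) {x y : ℝ}
    (hx : x = cos (2 * π * i / q)) (hy : y = cos (2 * π * (i + 1 : ℕ) / q)) (hx1 : x < 1)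
    (hx2 : -1 / 2 < x) (hy2 : y < -1 / 2) (hxy : 0 < 1 / 2 + x * y) :
    turanA (3 / q) = (1 - x) * (1 - y) / (q * (1 / 2 + x * y)) := by
  refine IsGreatest.csSup_eq ⟨⟨hatCoeff q (-(x + y) / (2 * (1 / 2 + x * y)))
    (1 / (4 * (1 / 2 + x * y))), memK_hatCoeff hq fun n => ?_, ?_⟩, ?_⟩
  · have := cos_sub_mul_cos_sub_nonneg hi n
    rw [← hx, ← hy] at this
    refine (div_nonneg this hxy.le).trans_eq ?_
    generalize hD : 1 / 2 + x * y = D at hxy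
    field_simp
    linear_combination 4 * hD
  · rw [hatCoeff_zero]
    have : (q : ℝ) ≠ 0 := by positivity
    generalize hD : 1 / 2 + x * y = D at hxy
    field_simp
    linear_combination 4 * hD
  · rintro _ ⟨a, ha, rfl⟩
    exact ha.apply_zero_le (by omega) hx hy hx1 hx2 hy2 hxy

theorem sin_sub_isBigO : (fun u : ℝ => sin u - (u - u ^ 3 / 6)) =O[nhds 0] fun u => u ^ 5 := by
  refine IsBigO.of_bound (1 / 100) ?_
  filter_upwards [Metric.closedBall_mem_nhds (0 : ℝ) one_pos] with u hu
  have := sin_bound (x := u) (by simpa using hu)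
  rw [norm_eq_abs, norm_eq_abs, abs_pow]
  linarith

theorem cos_sub_isBigO :
    (fun u : ℝ => cos u - (1 - u ^ 2 / 2 + u ^ 4 / 24)) =O[nhds 0] fun u => u ^ 5 := by
  have htend : Tendsto (fun u : ℝ => u / 2) (nhds 0) (nhds 0) := by
    simpa using (continuous_id.div_const (2 : ℝ)).tendsto 0
  have hs : (fun u : ℝ => sin (u / 2) - (u / 2 - (u / 2) ^ 3 / 6)) =O[nhds 0] fun u => u ^ 5 :=
    (sin_sub_isBigO.comp_tendsto htend).trans <| IsBigO.of_bound 1 <| Eventually.of_forall fun u => by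
      simp only [Function.comp, div_pow, norm_div, norm_pow, Real.norm_ofNat]
      have : 0 ≤ ‖u‖ ^ 5 := by positivity
      linarith
  have hb : (fun u : ℝ => -2 * (sin (u / 2) + (u / 2 - (u / 2) ^ 3 / 6))) =O[nhds 0]
      fun _ => (1 : ℝ) :=
    (Continuous.tendsto (by fun_prop) 0).isBigO_one ℝ
  have hu : (fun u : ℝ => u ^ 5 * (-u / 1152)) =O[nhds 0] fun u => u ^ 5 := by
    have : (fun u : ℝ => -u / 1152) =O[nhds 0] fun _ => (1 : ℝ) :=
      (Continuous.tendsto (by fun_prop) 0).isBigO_one ℝ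
    simpa using (isBigO_refl (fun u : ℝ => u ^ 5) _).mul this
  have h := (hs.mul hb).congr_right (fun u => mul_one (u ^ 5)) |>.add hu
  refine h.congr_left fun u => ?_
  have hcos : cos u = 2 * cos (u / 2) ^ 2 - 1 := by rw [← cos_two_mul]; ring_nf
  linear_combination -hcos - 2 * sin_sq_add_cos_sq (u / 2)

/-- The value `3 A(h) / h` for `h = 3 / q`, `q ≡ 2 mod 3`, as a function of `u = 2πh/9`. -/
noncomputable def turanProfile (u : ℝ) : ℝ :=
  (1 - cos (2 * π / 3 - 2 * u)) * (1 - cos (2 * π / 3 + u)) /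
    (1 / 2 + cos (2 * π / 3 - 2 * u) * cos (2 * π / 3 + u))

theorem cos_two_pi_div_three : cos (2 * π / 3) = -1 / 2 := by
  rw [show 2 * π / 3 = π - π / 3 by ring, cos_pi_sub, cos_pi_div_three]
  norm_num

theorem sin_two_pi_div_three : sin (2 * π / 3) = √3 / 2 := by
  rw [show 2 * π / 3 = π - π / 3 by ring, sin_pi_sub, sin_pi_div_three]

theorem cos_two_pi_div_three_add_isBigO :
    (fun u : ℝ => cos (2 * π / 3 + u) -
      (-1 / 2 - √3 / 2 * u + u ^ 2 / 4 + √3 / 12 * u ^ 3 - u ^ 4 / 48)) =O[nhds 0] fun u => u ^ 5 := by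
  refine ((cos_sub_isBigO.const_mul_left (-1 / 2)).sub
    (sin_sub_isBigO.const_mul_left (√3 / 2))).congr_left fun u => ?_
  rw [cos_add, cos_two_pi_div_three, sin_two_pi_div_three]
  ring

theorem cos_two_pi_div_three_sub_isBigO :
    (fun u : ℝ => cos (2 * π / 3 - 2 * u) -
      (-1 / 2 + √3 * u + u ^ 2 - 2 / 3 * √3 * u ^ 3 - u ^ 4 / 3)) =O[nhds 0] fun u => u ^ 5 := by
  have htend : Tendsto (fun u : ℝ => -2 * u) (nhds 0) (nhds 0) := by
    simpa using (continuous_const_mul (-2 : ℝ)).tendsto 0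
  refine (cos_two_pi_div_three_add_isBigO.comp_tendsto htend).trans ?_ |>.congr_left fun u => ?_
  · refine (isBigO_const_mul_self ((-2 : ℝ) ^ 5) (fun u : ℝ => u ^ 5) _).congr_left fun u => ?_
    simp only [Function.comp, mul_pow]
  · simp only [Function.comp]
    rw [show 2 * π / 3 + -2 * u = 2 * π / 3 - 2 * u by ring]
    ring

theorem turanProfile_isBigO :
    (fun u : ℝ => turanProfile u - 3 * (1 + 4 / 3 * u ^ 2 + 2 * √3 / 3 * u ^ 3 + 28 / 9 * u ^ 4))
      =O[nhds 0] fun u => u ^ 5 := by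
  set s := √3 with hs
  have hs2 : s ^ 2 = 3 := Real.sq_sqrt (by norm_num)
  have bdd {f : ℝ → ℝ} (hf : ContinuousAt f 0) : f =O[nhds 0] fun _ => (1 : ℝ) := hf.isBigO_one ℝ
  have hD0 : 1 / 2 + cos (2 * π / 3 - 2 * 0) * cos (2 * π / 3 + 0) = 3 / 4 := by
    rw [mul_zero, sub_zero, add_zero, cos_two_pi_div_three]
    norm_num
  have hDc : ContinuousAt (fun u : ℝ => 1 / 2 + cos (2 * π / 3 - 2 * u) * cos (2 * π / 3 + u)) 0 :=
    Continuous.continuousAt (by fun_prop)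
  have hDne : ∀ᶠ u in nhds (0 : ℝ), 1 / 2 + cos (2 * π / 3 - 2 * u) * cos (2 * π / 3 + u) ≠ 0 :=
    hDc.eventually_ne (by rw [hD0]; norm_num)
  have hDinv := bdd (hDc.inv₀ (by rw [hD0]; norm_num))
  have h1 := (isBigO_refl (fun u : ℝ => u ^ 5) (nhds 0)).mul (bdd (f := fun u =>
    79 / 24 * s + s ^ 3 + (13 / 3 + 109 / 36 * s ^ 2) * u - (211 / 144 * s + 5 / 6 * s ^ 3) * u ^ 2 -
      (43 / 12 + 91 / 24 * s ^ 2) * u ^ 3 + (-23 / 72 * s + 1 / 9 * s ^ 3) * u ^ 4 +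
      (17 / 18 + 59 / 108 * s ^ 2) * u ^ 5 + 25 / 216 * s * u ^ 6 - 7 / 108 * u ^ 7)
    (Continuous.continuousAt (by fun_prop)))
  have h2 := cos_two_pi_div_three_sub_isBigO.mul (bdd (f := fun u =>
    -(1 - cos (2 * π / 3 + u)) - 3 * (1 + 4 / 3 * u ^ 2 + 2 * s / 3 * u ^ 3 + 28 / 9 * u ^ 4) *
      cos (2 * π / 3 + u)) (Continuous.continuousAt (by fun_prop)))
  have h3 := cos_two_pi_div_three_add_isBigO.mul (bdd (f := fun u =>
    -(1 - (-1 / 2 + s * u + u ^ 2 - 2 / 3 * s * u ^ 3 - u ^ 4 / 3)) -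
      3 * (1 + 4 / 3 * u ^ 2 + 2 * s / 3 * u ^ 3 + 28 / 9 * u ^ 4) *
      (-1 / 2 + s * u + u ^ 2 - 2 / 3 * s * u ^ 3 - u ^ 4 / 3)) (Continuous.continuousAt (by fun_prop)))
  refine (((h1.add h2).add h3).mul hDinv).congr' ?_ (Eventually.of_forall fun u => by ring)
  filter_upwards [hDne] with u hu
  rw [turanProfile, eq_sub_iff_add_eq, eq_div_iff hu, add_mul, mul_assoc, Pi.inv_apply,
    inv_mul_cancel₀ hu, ← hs]
  linear_combination -(u ^ 2 + 5 / 3 * u ^ 4) * hs2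

theorem turanA_three_div_eq_profile {ν : ℕ} (hν : 2 ≤ ν) :
    turanA (3 / (3 * (ν : ℝ) + 2)) =
      turanProfile (2 * π / 9 * (3 / (3 * (ν : ℝ) + 2))) * (1 / 3 * (3 / (3 * (ν : ℝ) + 2))) := by
  have hν' : (2 : ℝ) ≤ ν := by exact_mod_cast hν
  have hq : ((3 * ν + 2 : ℕ) : ℝ) = 3 * (ν : ℝ) + 2 := by push_cast; ring
  have hq0 : (0 : ℝ) < 3 * ν + 2 := by positivity
  have hpi := pi_pos
  set x := cos (2 * π * ν / (3 * ν + 2 : ℕ)) with hx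
  set y := cos (2 * π * (ν + 1 : ℕ) / (3 * ν + 2 : ℕ)) with hy
  have hx2 : -1 / 2 < x := by
    rw [← cos_two_pi_div_three, hx, hq]
    refine cos_lt_cos_of_nonneg_of_le_pi (by positivity) (by linarith) ?_
    rw [div_lt_div_iff₀ hq0 (by norm_num)]
    nlinarith
  have hy2 : y < -1 / 2 := by
    rw [← cos_two_pi_div_three, hy, hq, Nat.cast_add_one]
    refine cos_lt_cos_of_nonneg_of_le_pi (by positivity) ?_ ?_
    · rw [div_le_iff₀ hq0]
      nlinarith
    · rw [div_lt_div_iff₀ (by norm_num) hq0]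
      nlinarith
  have hx0 : x ≤ 0 := by
    rw [hx, hq]
    refine cos_nonpos_of_pi_div_two_le_of_le ?_ ?_
    · rw [div_le_div_iff₀ (by norm_num) hq0]
      nlinarith
    · rw [div_le_iff₀ hq0]
      nlinarith
  have hxy : 0 < 1 / 2 + x * y := by nlinarith
  have h := turanA_three_div_eq (q := 3 * ν + 2) (i := ν) (by omega) (by omega) hx hy (by linarith)
    hx2 hy2 hxy
  have ex : x = cos (2 * π / 3 - 2 * (2 * π / 9 * (3 / (3 * (ν : ℝ) + 2)))) := by
    rw [hx, hq]
    congr 1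
    field_simp
    ring
  have ey : y = cos (2 * π / 3 + 2 * π / 9 * (3 / (3 * (ν : ℝ) + 2))) := by
    rw [hy, hq, Nat.cast_add_one]
    congr 1
    field_simp
    ring
  rw [hq] at h
  rw [h, turanProfile, ← ex, ← ey]
  field_simp

/-- Corollary, case `h = 3/q`, `q = 3ν+2`: as `q → ∞`, with `h = 3/q`,
`A(h) = h + (16π²/243) h³ + (16π³√3/2187) h⁴ + (448π⁴/59049) h⁵ + O(h⁶)`. -/
theorem turanA_asymptotic_three_div_two_mod :
    (fun ν : ℕ => turanA (3 / (3 * (ν : ℝ) + 2)) -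
        (3 / (3 * (ν : ℝ) + 2) + 16 * π ^ 2 / 243 * (3 / (3 * (ν : ℝ) + 2)) ^ 3 +
          16 * π ^ 3 * Real.sqrt 3 / 2187 * (3 / (3 * (ν : ℝ) + 2)) ^ 4 +
          448 * π ^ 4 / 59049 * (3 / (3 * (ν : ℝ) + 2)) ^ 5)) =O[atTop]
      fun ν : ℕ => (3 / (3 * (ν : ℝ) + 2)) ^ 6 := by
  have hh : Tendsto (fun ν : ℕ => 3 / (3 * (ν : ℝ) + 2)) atTop (nhds 0) :=
    tendsto_const_nhds.div_atTop <| tendsto_atTop_add_const_right _ _ <|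
      tendsto_natCast_atTop_atTop.const_mul_atTop (by norm_num)
  have hu : Tendsto (fun ν : ℕ => 2 * π / 9 * (3 / (3 * (ν : ℝ) + 2))) atTop (nhds 0) := by
    simpa using hh.const_mul (2 * π / 9)
  have h1 : (fun ν : ℕ => (2 * π / 9 * (3 / (3 * (ν : ℝ) + 2))) ^ 5) =O[atTop]
      fun ν : ℕ => (3 / (3 * (ν : ℝ) + 2)) ^ 5 :=
    (isBigO_const_mul_self ((2 * π / 9) ^ 5) _ _).congr_left fun ν => (mul_pow _ _ _).symm
  have h2 : (fun ν : ℕ => 1 / 3 * (3 / (3 * (ν : ℝ) + 2))) =O[atTop]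
      fun ν : ℕ => 3 / (3 * (ν : ℝ) + 2) := isBigO_const_mul_self _ _ _
  refine (((turanProfile_isBigO.comp_tendsto hu).trans h1).mul h2).congr' ?_
    (Eventually.of_forall fun ν => (pow_succ _ _).symm)
  filter_upwards [eventually_ge_atTop 2] with ν hν
  rw [turanA_three_div_eq_profile hν]
  simp only [Function.comp]
  ring
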